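/- Let σ, τ be weight functions in the class W₀ with associated weight matrices {S^(ℓ) : ℓ > 0} and {T^(ℓ) : ℓ > 0}, and assume γ̄(τ) < γ(σ) (as elements of [0,+∞]; in particular γ̄(τ) < +∞). Then the following are equivalent: (i) σ⋆̂τ is well-defined; (ii) ω_{S^(ℓ)}⋆̂τ is well-defined for some ℓ > 0; (ii') ω_{S^(ℓ)}⋆̂τ is well-defined for all ℓ > 0; (iii) σ⋆̂ω_{T^(ℓ)} is well-defined for some ℓ > 0; (iii') σ⋆̂ω_{T^(ℓ)} is well-defined for all ℓ > 0; (iv) T^(ℓ₁) ◁ S^(ℓ) for all ℓ, ℓ₁ > 0. Moreover, if these equivalent assertions hold, then for all ℓ, ℓ₁, ℓ₂, ℓ₃ > 0 one has σ⋆̂τ ~ ω_{S^(ℓ)}⋆̂τ ~ σ⋆̂ω_{T^(ℓ₁)} ~ ω_{S^(ℓ₂)}⋆̂ω_{T^(ℓ₃)}. -/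

import Mathlib

open Real Filter Asymptotics Set
open scoped ENNReal Topology

noncomputable section

/-- A weight function: nonnegative, non-decreasing on `[0,∞)`, tending to `+∞`. -/
def IsWeightFct (ω : ℝ → ℝ) : Prop :=
  (∀ t : ℝ, 0 ≤ ω t) ∧ MonotoneOn ω (Ici (0:ℝ)) ∧ Tendsto ω atTop atTop

/-- Condition `(ω₁)`: `ω(2t) = O(ω(t))`. -/
def HasOm1 (ω : ℝ → ℝ) : Prop :=
  ∃ L : ℝ, 1 ≤ L ∧ ∀ t : ℝ, 0 ≤ t → ω (2 * t) ≤ L * (ω t + 1)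

/-- Condition `(ω₆)`. -/
def HasOm6 (ω : ℝ → ℝ) : Prop :=
  ∃ H : ℝ, 1 ≤ H ∧ ∀ t : ℝ, 0 ≤ t → 2 * ω t ≤ ω (H * t) + H

/-- The class `W₀` of (normalized) Braun-Meise-Taylor weight functions. -/
def IsW0 (ω : ℝ → ℝ) : Prop :=
  IsWeightFct ω ∧ ContinuousOn ω (Ici (0:ℝ)) ∧ (∀ t ∈ Icc (0:ℝ) 1, ω t = 0) ∧
    ((fun t : ℝ => Real.log t) =o[atTop] ω) ∧
    ConvexOn ℝ univ (fun y : ℝ => ω (Real.exp y))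

/-- Legendre-Fenchel-Young conjugate `φ*_ω`. -/
def phiStar (ω : ℝ → ℝ) (x : ℝ) : ℝ :=
  sSup {z : ℝ | ∃ y : ℝ, 0 ≤ y ∧ z = x * y - ω (Real.exp y)}

/-- The sequence `W^(ℓ)` of the associated weight matrix of `ω`. -/
def assocSeq (ω : ℝ → ℝ) (ℓ : ℝ) (p : ℕ) : ℝ :=
  Real.exp ((1 / ℓ) * phiStar ω (ℓ * (p : ℝ)))

/-- The weight function `ω_M` associated with a sequence `M`. -/
def omegaSeq (M : ℕ → ℝ) (t : ℝ) : ℝ :=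
  sSup {z : ℝ | ∃ p : ℕ, z = Real.log (t ^ p / M p)}

/-- Property `(P_{ω,γ})`. -/
def gammaProp (ω : ℝ → ℝ) (g : ℝ) : Prop :=
  ∃ K : ℝ, 1 < K ∧
    limsup (fun t : ℝ => ((ω (K ^ g * t) / ω t : ℝ) : EReal)) atTop < (K : EReal)

/-- Property `(P̄_{ω,γ})`. -/
def gammaBarProp (ω : ℝ → ℝ) (g : ℝ) : Prop :=
  ∃ A : ℝ, 1 < A ∧
    (A : EReal) < liminf (fun t : ℝ => ((ω (A ^ g * t) / ω t : ℝ) : EReal)) atTop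

/-- The growth index `γ(ω) ∈ [0,∞]`. -/
def gammaIdx (ω : ℝ → ℝ) : ℝ≥0∞ :=
  ⨆ (g : ℝ) (_ : 0 < g ∧ gammaProp ω g), ENNReal.ofReal g

/-- The growth index `γ̄(ω) ∈ [0,∞]` (`+∞` if no admissible `γ` exists). -/
def gammaBarIdx (ω : ℝ → ℝ) : ℝ≥0∞ :=
  sInf (ENNReal.ofReal '' {g : ℝ | 0 < g ∧ gammaBarProp ω g})

/-- Generalized lower Legendre conjugate `σ ⋆̌ τ`. -/
def lowerConj (σ τ : ℝ → ℝ) (t : ℝ) : ℝ :=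
  sInf {z : ℝ | ∃ s : ℝ, 0 < s ∧ z = σ s + τ (t / s)}

/-- Generalized upper Legendre conjugate `σ ⋆̂ τ`. -/
def upperConj (σ τ : ℝ → ℝ) (t : ℝ) : ℝ :=
  if t = 0 then σ 0 - τ 0 else sSup {z : ℝ | ∃ s : ℝ, 0 ≤ s ∧ z = σ s - τ (s / t)}

/-- `σ ⋆̂ τ` is well-defined, i.e. `σ⋆̂τ(t) < +∞` for every `t`. -/
def UpperConjWD (σ τ : ℝ → ℝ) : Prop :=
  ∀ t : ℝ, 0 < t → BddAbove {z : ℝ | ∃ s : ℝ, 0 ≤ s ∧ z = σ s - τ (s / t)}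

/-- Lower Legendre envelope `h_⋆`. -/
def lowerEnv (h : ℝ → ℝ) (t : ℝ) : ℝ :=
  sInf {z : ℝ | ∃ u : ℝ, 0 < u ∧ z = h u + t * u}

/-- Upper Legendre envelope `h^⋆`. -/
def upperEnv (h : ℝ → ℝ) (t : ℝ) : ℝ :=
  sSup {z : ℝ | ∃ s : ℝ, 0 ≤ s ∧ z = h s - t * s}

/-- `(((ω^ι)^α)_⋆)^{1/α}` (which equals `ω ⋆̌ id^{1/α}`). -/
def lowerCompose (ω : ℝ → ℝ) (α : ℝ) (t : ℝ) : ℝ :=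
  lowerEnv (fun u : ℝ => ω (1 / u ^ α)) (t ^ (1 / α))

/-- `(((ω^α)^⋆)^ι)^{1/α}` (which equals `ω ⋆̂ id^{1/α}`). -/
def upperCompose (ω : ℝ → ℝ) (α : ℝ) (t : ℝ) : ℝ :=
  upperEnv (fun s : ℝ => ω (s ^ α)) (1 / t ^ (1 / α))

/-- Equivalence `σ ∼ τ` of weight functions. -/
def WeightEquiv (σ τ : ℝ → ℝ) : Prop :=
  σ =O[atTop] τ ∧ τ =O[atTop] σ

/-- Relation `M ≼ N` for sequences: `sup_{p ≥ 1} (M_p/N_p)^{1/p} < ∞`. -/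
def seqPrec (M N : ℕ → ℝ) : Prop :=
  ∃ C : ℝ, ∀ p : ℕ, 1 ≤ p → (M p / N p) ^ (1 / (p : ℝ)) ≤ C

/-- Relation `M ◁ N` for sequences: `(M_p/N_p)^{1/p} → 0`. -/
def seqTriangle (M N : ℕ → ℝ) : Prop :=
  Tendsto (fun p : ℕ => (M p / N p) ^ (1 / (p : ℝ))) atTop (𝓝 0)

/-- Equivalence `M ≈ N` of sequences. -/
def seqEquiv (M N : ℕ → ℝ) : Prop := seqPrec M N ∧ seqPrec N M

/-- The Gevrey sequence `G^α`. -/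
def gevrey (α : ℝ) (p : ℕ) : ℝ := (p.factorial : ℝ) ^ α

/-- The quotient sequence `μ_p = M_p / M_{p-1}`, `μ₀ = 1`. -/
def quotSeq (M : ℕ → ℝ) : ℕ → ℝ
  | 0 => 1
  | (p + 1) => M (p + 1) / M p

/-- Condition `(β,Q)`: `liminf_{p} μ_{Qp}/μ_p > Q^β`. -/
def condBQ (M : ℕ → ℝ) (β : ℝ) (Q : ℕ) : Prop :=
  ((((Q : ℝ) ^ β : ℝ)) : EReal) <
    liminf (fun p : ℕ => ((quotSeq M (Q * p) / quotSeq M p : ℝ) : EReal)) atTop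

/-- Thilliez's growth index `γ(M) ∈ [0,∞]`. -/
def thilliezIdx (M : ℕ → ℝ) : ℝ≥0∞ :=
  ⨆ (β : ℝ) (_ : 0 ≤ β ∧ ∃ Q : ℕ, 2 ≤ Q ∧ condBQ M β Q), ENNReal.ofReal β

/-- The Beurling Gelfand-Shilov space `S_(σ)(ℝ)` (membership predicate). -/
def MemSBeurling (σ : ℝ → ℝ) (f : ℝ → ℂ) : Prop :=
  ContDiff ℝ (⊤ : ℕ∞) f ∧ ∀ ℓ : ℝ, 0 < ℓ → ∃ C : ℝ, ∀ x : ℝ, ∀ j k : ℕ,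
    (1 + |x|) ^ k * ‖iteratedDeriv j f x‖ ≤ C * assocSeq σ ℓ (j + k)

/-- The polynomial `ψ(x) = x² + 1/4`. -/
def psiMap (x : ℝ) : ℝ := x ^ 2 + 1 / 4

/-- The resolvent operator `R_μ = ∑_m C_{ψ_m}/μ^{m+1}`. -/
def Rres (μ : ℂ) (f : ℝ → ℂ) (x : ℝ) : ℂ :=
  ∑' m : ℕ, (μ ^ (m + 1))⁻¹ * f (psiMap^[m] x)

lemma IsW0.exists_mul_log_le {ω : ℝ → ℝ} (h : IsW0 ω) (x : ℝ) (hx : 0 ≤ x) :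
    ∃ D : ℝ, 0 ≤ D ∧ ∀ t : ℝ, 1 ≤ t → x * Real.log t ≤ ω t + D := by
  obtain ⟨⟨hpos, -, -⟩, -, -, hlog, -⟩ := h
  have hev := hlog.def (c := 1 / (x + 1)) (by positivity)
  obtain ⟨t₀, ht₀⟩ := eventually_atTop.1 hev
  have hlog₀ : 0 ≤ Real.log (max t₀ 1) := Real.log_nonneg (le_max_right _ _)
  refine ⟨x * Real.log (max t₀ 1), by positivity, fun t ht => ?_⟩
  rcases le_total t (max t₀ 1) with htt | htt
  · have : Real.log t ≤ Real.log (max t₀ 1) := Real.log_le_log (by linarith) htt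
    nlinarith [hpos t]
  · have hb := ht₀ t ((le_max_left _ _).trans htt)
    have hl : 0 ≤ Real.log t := Real.log_nonneg ht
    rw [Real.norm_of_nonneg hl, Real.norm_of_nonneg (hpos t), one_div, inv_mul_eq_div,
      le_div_iff₀ (by positivity)] at hb
    nlinarith

lemma IsW0.bddAbove_phiStar {ω : ℝ → ℝ} (h : IsW0 ω) (x : ℝ) (hx : 0 ≤ x) :
    BddAbove {z : ℝ | ∃ y : ℝ, 0 ≤ y ∧ z = x * y - ω (Real.exp y)} := by
  obtain ⟨D, -, hD⟩ := h.exists_mul_log_le x hx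
  refine ⟨D, ?_⟩
  rintro _ ⟨y, hy, rfl⟩
  have := hD (Real.exp y) (Real.one_le_exp hy)
  rw [Real.log_exp] at this
  linarith

lemma IsW0.le_phiStar {ω : ℝ → ℝ} (h : IsW0 ω) {x y : ℝ} (hx : 0 ≤ x) (hy : 0 ≤ y) :
    x * y - ω (Real.exp y) ≤ phiStar ω x :=
  le_csSup (h.bddAbove_phiStar x hx) ⟨y, hy, rfl⟩

lemma phiStar_le {ω : ℝ → ℝ} {x B : ℝ}
    (h : ∀ y : ℝ, 0 ≤ y → x * y - ω (Real.exp y) ≤ B) : phiStar ω x ≤ B := by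
  refine csSup_le ⟨_, 0, le_rfl, rfl⟩ ?_
  rintro _ ⟨y, hy, rfl⟩
  exact h y hy

lemma IsW0.phiStar_nonneg {ω : ℝ → ℝ} (h : IsW0 ω) {x : ℝ} (hx : 0 ≤ x) : 0 ≤ phiStar ω x := by
  have := h.le_phiStar hx le_rfl
  rwa [Real.exp_zero, h.2.2.1 1 (by simp), mul_zero, sub_zero] at this

lemma IsW0.one_le_assocSeq {ω : ℝ → ℝ} (h : IsW0 ω) {l : ℝ} (hl : 0 < l) (p : ℕ) :
    1 ≤ assocSeq ω l p :=
  Real.one_le_exp (mul_nonneg (by positivity) (h.phiStar_nonneg (by positivity)))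

lemma log_pow_div_assocSeq (ω : ℝ → ℝ) (l : ℝ) (p : ℕ) {t : ℝ} (ht : 0 < t) :
    Real.log (t ^ p / assocSeq ω l p) = p * Real.log t - 1 / l * phiStar ω (l * p) := by
  rw [assocSeq, Real.log_div (by positivity) (Real.exp_pos _).ne', Real.log_pow, Real.log_exp]

lemma IsW0.log_pow_div_assocSeq_le {ω : ℝ → ℝ} (h : IsW0 ω) {l : ℝ} (hl : 0 < l) (p : ℕ)
    {t : ℝ} (ht : 0 ≤ t) : Real.log (t ^ p / assocSeq ω l p) ≤ ω t / l := by
  have hM := h.one_le_assocSeq hl p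
  rcases le_total t 1 with h1 | h1
  · refine (Real.log_nonpos (by positivity) ?_).trans (div_nonneg (h.1.1 t) hl.le)
    rw [div_le_one (by linarith)]
    exact (pow_le_one₀ ht h1).trans hM
  · have hp := h.le_phiStar (x := l * p) (by positivity) (Real.log_nonneg h1)
    rw [Real.exp_log (by linarith)] at hp
    rw [log_pow_div_assocSeq _ _ _ (by linarith), le_div_iff₀ hl]
    have : (p * Real.log t - 1 / l * phiStar ω (l * p)) * l
        = l * p * Real.log t - phiStar ω (l * p) := by field_simp
    linarith

lemma IsW0.le_omegaSeq {ω : ℝ → ℝ} (h : IsW0 ω) {l : ℝ} (hl : 0 < l) (p : ℕ)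
    {t : ℝ} (ht : 0 ≤ t) :
    Real.log (t ^ p / assocSeq ω l p) ≤ omegaSeq (assocSeq ω l) t := by
  refine le_csSup ⟨ω t / l, ?_⟩ ⟨p, rfl⟩
  rintro _ ⟨q, rfl⟩
  exact h.log_pow_div_assocSeq_le hl q ht

lemma IsW0.omegaSeq_le {ω : ℝ → ℝ} (h : IsW0 ω) {l : ℝ} (hl : 0 < l) {t : ℝ} (ht : 0 ≤ t) :
    omegaSeq (assocSeq ω l) t ≤ ω t / l := by
  refine csSup_le ⟨_, 0, rfl⟩ ?_
  rintro _ ⟨q, rfl⟩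
  exact h.log_pow_div_assocSeq_le hl q ht

lemma IsW0.omegaSeq_nonneg {ω : ℝ → ℝ} (h : IsW0 ω) {l : ℝ} (hl : 0 < l) {t : ℝ} (ht : 0 ≤ t) :
    0 ≤ omegaSeq (assocSeq ω l) t := by
  have h0 : phiStar ω 0 ≤ 0 := phiStar_le fun y _ => by linarith [h.1.1 (Real.exp y)]
  have h1 : phiStar ω 0 = 0 := le_antisymm h0 (h.phiStar_nonneg le_rfl)
  simpa [assocSeq, h1] using h.le_omegaSeq hl 0 ht

/-- A nonnegative-slope affine minorant of `y ↦ ω (exp y)` that is almost exact at `y`. -/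
lemma IsW0.exists_affine_minorant {ω : ℝ → ℝ} (h : IsW0 ω) (y : ℝ) :
    ∃ c c' : ℝ, 0 ≤ c ∧ (∀ z : ℝ, c * z + c' ≤ ω (Real.exp z)) ∧
      c * y + c' = ω (Real.exp y) - 1 := by
  obtain ⟨-, hcont, hzero, -, hconv⟩ := h
  have hc : Continuous (fun y : ℝ => ω (Real.exp y)) :=
    hcont.comp_continuous Real.continuous_exp fun x => (Real.exp_pos x).le
  obtain ⟨c, c', hle, heq⟩ := hconv.exists_affine_le_of_lt_real (x := y)
    (a := ω (Real.exp y) - 1) (mem_univ y) (by linarith) isClosed_univ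
    (hc.lowerSemicontinuous.lowerSemicontinuousOn _)
  refine ⟨c, c', ?_, fun z => hle z (mem_univ z), heq⟩
  by_contra! hneg
  have hz : (|c'| + 1) / c ≤ 0 := div_nonpos_of_nonneg_of_nonpos (by positivity) hneg.le
  have hz' := hle ((|c'| + 1) / c) (mem_univ _)
  rw [mul_div_cancel₀ _ hneg.ne,
    hzero _ ⟨(Real.exp_pos _).le, Real.exp_le_one_iff.2 hz⟩] at hz'
  linarith [neg_abs_le c']

lemma IsW0.le_mul_omegaSeq_add_log {ω : ℝ → ℝ} (h : IsW0 ω) {l : ℝ} (hl : 0 < l) {t : ℝ}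
    (ht : 1 ≤ t) : ω t ≤ l * omegaSeq (assocSeq ω l) t + l * Real.log t + 1 := by
  have hy : 0 ≤ Real.log t := Real.log_nonneg ht
  obtain ⟨c, c', hc, hle, heq⟩ := h.exists_affine_minorant (Real.log t)
  rw [Real.exp_log (by linarith)] at heq
  have hp₁ : l * (⌊c / l⌋₊ : ℝ) ≤ c := by
    have := Nat.floor_le (div_nonneg hc hl.le)
    rwa [le_div_iff₀ hl, mul_comm] at this
  have hp₂ : c ≤ l * ((⌊c / l⌋₊ : ℝ) + 1) := by
    have := (Nat.lt_floor_add_one (c / l)).le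
    rwa [div_le_iff₀ hl, mul_comm] at this
  have hφ : phiStar ω (l * (⌊c / l⌋₊ : ℝ)) ≤ -c' := phiStar_le fun z hz => by
    nlinarith [hle z]
  have hω := h.le_omegaSeq hl ⌊c / l⌋₊ (t := t) (by linarith)
  rw [log_pow_div_assocSeq _ _ _ (by linarith)] at hω
  have hω' := mul_le_mul_of_nonneg_left hω hl.le
  have hexp : l * ((⌊c / l⌋₊ : ℝ) * Real.log t - 1 / l * phiStar ω (l * (⌊c / l⌋₊ : ℝ)))
      = l * (⌊c / l⌋₊ : ℝ) * Real.log t - phiStar ω (l * (⌊c / l⌋₊ : ℝ)) := by field_simp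
  nlinarith

/-- `f` is linearly dominated by `g` on `[0,∞)`. -/
def LinDom (f g : ℝ → ℝ) : Prop :=
  ∃ K : ℝ, 0 < K ∧ ∀ t : ℝ, 0 ≤ t → f t ≤ K * (g t + 1)

lemma LinDom.refl (ω : ℝ → ℝ) : LinDom ω ω :=
  ⟨1, one_pos, fun t _ => by linarith⟩

lemma IsW0.linDom_omegaSeq_left {ω : ℝ → ℝ} (h : IsW0 ω) {l : ℝ} (hl : 0 < l) :
    LinDom (omegaSeq (assocSeq ω l)) ω := by
  refine ⟨1 / l, by positivity, fun t ht => (h.omegaSeq_le hl ht).trans ?_⟩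
  rw [div_eq_inv_mul, one_div]
  gcongr
  linarith

lemma IsW0.linDom_omegaSeq_right {ω : ℝ → ℝ} (h : IsW0 ω) {l : ℝ} (hl : 0 < l) :
    LinDom ω (omegaSeq (assocSeq ω l)) := by
  obtain ⟨D, hD₀, hD⟩ := h.exists_mul_log_le (2 * l) (by positivity)
  refine ⟨2 * l + D + 2, by positivity, fun t ht => ?_⟩
  have hnn := h.omegaSeq_nonneg hl ht
  rcases le_total t 1 with h1 | h1
  · rw [h.2.2.1 t ⟨ht, h1⟩]
    positivity
  · have h₁ := h.le_mul_omegaSeq_add_log hl h1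
    have h₂ := hD t h1
    nlinarith

/-- Rescaling makes `τ` grow faster than `σ` by any prescribed factor. -/
def ScaleGap (σ τ : ℝ → ℝ) : Prop :=
  ∀ K : ℝ, 0 < K → ∃ lam : ℝ, 0 < lam ∧ ∃ M : ℝ, 0 < M ∧ ∃ D : ℝ, ∀ r : ℝ, 0 ≤ r →
    σ (lam * r) ≤ M * σ r + D ∧ K * M * τ r ≤ τ (lam * r) + D

lemma ScaleGap.exists_sub_le {σ τ σ₁ τ₁ σ₂ τ₂ : ℝ → ℝ} (hgap : ScaleGap σ τ)
    (h₁ : LinDom σ₁ σ) (h₂ : LinDom τ τ₁) (h₃ : LinDom σ σ₂) (h₄ : LinDom τ₂ τ) :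
    ∃ lam : ℝ, 0 < lam ∧ ∃ M : ℝ, 0 < M ∧ ∃ D : ℝ, ∀ s t : ℝ, 0 ≤ s → 0 < t →
      σ₁ s - τ₁ (s / t) ≤ M * (σ₂ (s / lam) - τ₂ (s / lam / t)) + D := by
  obtain ⟨K₁, hK₁, h₁⟩ := h₁
  obtain ⟨K₂, hK₂, h₂⟩ := h₂
  obtain ⟨K₃, hK₃, h₃⟩ := h₃
  obtain ⟨K₄, hK₄, h₄⟩ := h₄
  obtain ⟨lam, hlam, M, hM, D, h⟩ := hgap (K₁ * K₂ * K₃ * K₄) (by positivity)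
  refine ⟨lam, hlam, K₁ * M * K₃, by positivity,
    K₁ * M * K₃ + K₁ * D + K₁ + 1 + D / K₂ + K₁ * M * K₃ * K₄, fun s t hs ht => ?_⟩
  have hr : 0 ≤ s / lam := by positivity
  have hu : 0 ≤ s / lam / t := by positivity
  have hA := (h _ hr).1
  have hB := (h _ hu).2
  have e₁ : lam * (s / lam) = s := by field_simp
  have e₂ : lam * (s / lam / t) = s / t := by field_simp
  rw [e₁] at hA
  rw [e₂] at hB
  have hτ₁ : τ (s / t) / K₂ ≤ τ₁ (s / t) + 1 := by
    rw [div_le_iff₀ hK₂, mul_comm]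
    exact h₂ _ (by positivity)
  have hB' : K₁ * K₃ * K₄ * M * τ (s / lam / t) ≤ τ (s / t) / K₂ + D / K₂ := by
    rw [← add_div, le_div_iff₀ hK₂]
    linarith
  have hσ₁ := h₁ s hs
  have hσ := mul_le_mul_of_nonneg_left hA hK₁.le
  have hσ₂ := mul_le_mul_of_nonneg_left (h₃ _ hr) (by positivity : 0 ≤ K₁ * M)
  have hτ₂ := mul_le_mul_of_nonneg_left (h₄ _ hu) (by positivity : 0 ≤ K₁ * M * K₃)
  linarith

lemma ScaleGap.upperConjWD {σ τ σ₁ τ₁ : ℝ → ℝ} (hgap : ScaleGap σ τ)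
    (h₁ : LinDom σ₁ σ) (h₂ : LinDom τ τ₁) (hwd : UpperConjWD σ τ) : UpperConjWD σ₁ τ₁ := by
  obtain ⟨lam, hlam, M, hM, D, h⟩ := hgap.exists_sub_le h₁ h₂ (.refl σ) (.refl τ)
  intro t ht
  obtain ⟨B, hB⟩ := hwd t ht
  refine ⟨M * B + D, ?_⟩
  rintro _ ⟨s, hs, rfl⟩
  have := hB ⟨s / lam, by positivity, rfl⟩
  exact (h s t hs ht).trans (by gcongr)

lemma ScaleGap.exists_upperConj_le {σ τ σ₁ τ₁ σ₂ τ₂ : ℝ → ℝ} (hgap : ScaleGap σ τ)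
    (h₁ : LinDom σ₁ σ) (h₂ : LinDom τ τ₁) (h₃ : LinDom σ σ₂) (h₄ : LinDom τ₂ τ)
    (hwd : UpperConjWD σ₂ τ₂) :
    ∃ M : ℝ, 0 < M ∧ ∃ D : ℝ, ∀ t : ℝ, 0 < t →
      upperConj σ₁ τ₁ t ≤ M * upperConj σ₂ τ₂ t + D := by
  obtain ⟨lam, hlam, M, hM, D, h⟩ := hgap.exists_sub_le h₁ h₂ h₃ h₄
  refine ⟨M, hM, D, fun t ht => ?_⟩
  rw [upperConj, upperConj, if_neg ht.ne', if_neg ht.ne']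
  refine csSup_le ⟨_, 0, le_rfl, rfl⟩ ?_
  rintro _ ⟨s, hs, rfl⟩
  refine (h s t hs ht).trans ?_
  gcongr
  exact le_csSup (hwd t ht) ⟨s / lam, by positivity, rfl⟩

lemma tendsto_upperConj {σ₁ τ₁ : ℝ → ℝ} (hσ : Tendsto σ₁ atTop atTop)
    (hwd : UpperConjWD σ₁ τ₁) : Tendsto (upperConj σ₁ τ₁) atTop atTop := by
  refine tendsto_atTop_mono' _ ?_ (tendsto_atTop_add_const_right atTop (-τ₁ 1) hσ)
  filter_upwards [eventually_gt_atTop 0] with t ht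
  rw [upperConj, if_neg ht.ne']
  refine le_csSup (hwd t ht) ⟨t, ht.le, ?_⟩
  rw [div_self ht.ne', sub_eq_add_neg]

lemma isBigO_of_le_mul_add {f g : ℝ → ℝ} {M D : ℝ} (hf : Tendsto f atTop atTop)
    (hg : Tendsto g atTop atTop) (h : ∀ t : ℝ, 0 < t → f t ≤ M * g t + D) :
    f =O[atTop] g := by
  refine IsBigO.of_bound (M + |D|) ?_
  filter_upwards [eventually_gt_atTop 0, hf.eventually_ge_atTop 0,
    hg.eventually_ge_atTop 1] with t ht hft hgt
  rw [Real.norm_of_nonneg hft, Real.norm_of_nonneg (by linarith)]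
  nlinarith [h t ht, le_abs_self D, abs_nonneg D]

lemma LinDom.tendsto {f g : ℝ → ℝ} (h : LinDom f g) (hf : Tendsto f atTop atTop) :
    Tendsto g atTop atTop := by
  obtain ⟨K, hK, h⟩ := h
  refine tendsto_atTop_mono' _ ?_
    (tendsto_atTop_add_const_right atTop (-1) (hf.atTop_div_const hK))
  filter_upwards [eventually_ge_atTop 0] with t ht
  have := h t ht
  rw [← div_le_iff₀' hK] at this
  linarith

lemma ScaleGap.weightEquiv {σ τ σ₁ τ₁ : ℝ → ℝ} (hgap : ScaleGap σ τ)
    (hσ : Tendsto σ atTop atTop) (h₁ : LinDom σ₁ σ) (h₁' : LinDom σ σ₁) (h₂ : LinDom τ₁ τ) (h₂' : LinDom τ τ₁)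
    (hwd : UpperConjWD σ τ) : WeightEquiv (upperConj σ τ) (upperConj σ₁ τ₁) := by
  have hwd₁ := hgap.upperConjWD h₁ h₂' hwd
  have ht := tendsto_upperConj hσ hwd
  have ht₁ := tendsto_upperConj (h₁'.tendsto hσ) hwd₁
  obtain ⟨M, -, D, h⟩ := hgap.exists_upperConj_le (.refl σ) (.refl τ) h₁' h₂ hwd₁
  obtain ⟨M', -, D', h'⟩ := hgap.exists_upperConj_le h₁ h₂' (.refl σ) (.refl τ) hwd
  exact ⟨isBigO_of_le_mul_add ht ht₁ h, isBigO_of_le_mul_add ht₁ ht h'⟩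

lemma exists_pow_le_rpow_lt {K g lam : ℝ} (hK : 1 < K) (hg : 0 < g) (hlam : 1 ≤ lam) :
    ∃ n : ℕ, (K ^ g) ^ n ≤ lam ∧ lam ≤ (K ^ g) ^ (n + 1) ∧
      K ^ n ≤ lam ^ (1 / g) ∧ lam ^ (1 / g) ≤ K ^ (n + 1) := by
  have hK₀ : 0 ≤ K := by linarith
  obtain ⟨n, hn, hn'⟩ := exists_nat_pow_near
    (Real.one_le_rpow hlam (by positivity : 0 ≤ 1 / g)) hK
  have key : ∀ m : ℕ, (K ^ g) ^ m = (K ^ m) ^ g := fun m => by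
    rw [← Real.rpow_natCast, ← Real.rpow_natCast, ← Real.rpow_mul hK₀, ← Real.rpow_mul hK₀,
      mul_comm]
  have hl : (lam ^ (1 / g)) ^ g = lam := by
    rw [← Real.rpow_mul (by linarith), one_div_mul_cancel hg.ne', Real.rpow_one]
  refine ⟨n, ?_, ?_, hn, hn'.le⟩
  · rw [key, ← hl]
    exact Real.rpow_le_rpow (by positivity) hn hg.le
  · rw [key]
    nth_rewrite 1 [← hl]
    exact Real.rpow_le_rpow (by positivity) hn'.le hg.le

/-- Upper growth of a weight under dilation, with exponent `a`. -/
def DilUpper (ω : ℝ → ℝ) (a : ℝ) : Prop :=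
  ∃ C D : ℝ, 0 < C ∧ 0 ≤ D ∧ ∀ lam r : ℝ, 1 ≤ lam → 0 ≤ r →
    ω (lam * r) ≤ C * lam ^ a * (ω r + D)

/-- Lower growth of a weight under dilation, with exponent `b`. -/
def DilLower (ω : ℝ → ℝ) (b : ℝ) : Prop :=
  ∃ c D : ℝ, 0 < c ∧ 0 ≤ D ∧ ∀ lam r : ℝ, 1 ≤ lam → 0 ≤ r →
    c * lam ^ b * (ω r - D) ≤ ω (lam * r)

lemma dilUpper_of_gammaProp {ω : ℝ → ℝ} (h : IsWeightFct ω) {g : ℝ} (hg : 0 < g)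
    (hγ : gammaProp ω g) : DilUpper ω (1 / g) := by
  obtain ⟨K, hK, hlim⟩ := hγ
  obtain ⟨hpos, hmono, htend⟩ := h
  have hK₀ : 0 < K := by linarith
  obtain ⟨t₀, ht₀⟩ := eventually_atTop.1
    ((eventually_lt_of_limsup_lt hlim).and (htend.eventually_gt_atTop 0))
  set T := max t₀ 1
  have hT : 1 ≤ T := le_max_right _ _
  have hstep : ∀ t, T ≤ t → ω (K ^ g * t) ≤ K * ω t := fun t ht => by
    obtain ⟨h₁, h₂⟩ := ht₀ t ((le_max_left _ _).trans ht)
    exact ((div_lt_iff₀ h₂).1 (EReal.coe_lt_coe_iff.1 h₁)).le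
  have hKg : 1 ≤ K ^ g := Real.one_le_rpow hK.le hg.le
  have hiter : ∀ n : ℕ, ∀ t, T ≤ t → ω ((K ^ g) ^ n * t) ≤ K ^ n * ω t := fun n t ht => by
    induction n with
    | zero => simp
    | succ n ih =>
      have h1 : T ≤ (K ^ g) ^ n * t :=
        ht.trans (le_mul_of_one_le_left (by linarith) (one_le_pow₀ hKg))
      have h2 := hstep _ h1
      rw [← mul_assoc, ← pow_succ'] at h2
      rw [pow_succ' K, mul_assoc]
      exact h2.trans (by gcongr)
  have hbig : ∀ lam r, 1 ≤ lam → T ≤ r → ω (lam * r) ≤ K * lam ^ (1 / g) * ω r :=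
    fun lam r hlam hr => by
    obtain ⟨n, -, hn, hn', -⟩ := exists_pow_le_rpow_lt hK hg hlam
    have hr₀ : 0 ≤ r := by linarith
    calc ω (lam * r) ≤ ω ((K ^ g) ^ (n + 1) * r) :=
          hmono (mem_Ici.2 (by positivity)) (mem_Ici.2 (by positivity)) (by gcongr)
      _ ≤ K ^ (n + 1) * ω r := hiter _ _ hr
      _ ≤ K * lam ^ (1 / g) * ω r := by
          rw [pow_succ']
          have := hpos r
          gcongr
  refine ⟨K, ω T, hK₀, hpos T, fun lam r hlam hr => ?_⟩
  have hl : 0 ≤ K * lam ^ (1 / g) := by positivity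
  rcases le_total T r with hTr | hTr
  · exact (hbig lam r hlam hTr).trans
      (mul_le_mul_of_nonneg_left (by linarith [hpos T]) hl)
  · calc ω (lam * r) ≤ ω (lam * T) :=
          hmono (mem_Ici.2 (by positivity)) (mem_Ici.2 (by positivity)) (by gcongr)
      _ ≤ K * lam ^ (1 / g) * ω T := hbig lam T hlam le_rfl
      _ ≤ _ := mul_le_mul_of_nonneg_left (by linarith [hpos r]) hl

lemma dilLower_of_gammaBarProp {ω : ℝ → ℝ} (h : IsWeightFct ω) {g : ℝ} (hg : 0 < g)
    (hγ : gammaBarProp ω g) : DilLower ω (1 / g) := by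
  obtain ⟨A, hA, hlim⟩ := hγ
  obtain ⟨hpos, hmono, htend⟩ := h
  have hA₀ : 0 < A := by linarith
  obtain ⟨t₀, ht₀⟩ := eventually_atTop.1
    ((eventually_lt_of_lt_liminf hlim).and (htend.eventually_gt_atTop 0))
  set T := max t₀ 1
  have hT : 1 ≤ T := le_max_right _ _
  have hstep : ∀ t, T ≤ t → A * ω t ≤ ω (A ^ g * t) := fun t ht => by
    obtain ⟨h₁, h₂⟩ := ht₀ t ((le_max_left _ _).trans ht)
    exact ((lt_div_iff₀ h₂).1 (EReal.coe_lt_coe_iff.1 h₁)).le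
  have hAg : 1 ≤ A ^ g := Real.one_le_rpow hA.le hg.le
  have hiter : ∀ n : ℕ, ∀ t, T ≤ t → A ^ n * ω t ≤ ω ((A ^ g) ^ n * t) := fun n t ht => by
    induction n with
    | zero => simp
    | succ n ih =>
      have h1 : T ≤ (A ^ g) ^ n * t :=
        ht.trans (le_mul_of_one_le_left (by linarith) (one_le_pow₀ hAg))
      have h2 := hstep _ h1
      rw [← mul_assoc, ← pow_succ'] at h2
      rw [pow_succ' A, mul_assoc]
      exact le_trans (by gcongr) h2
  refine ⟨1 / A, ω T, by positivity, hpos T, fun lam r hlam hr => ?_⟩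
  have hl : 0 ≤ 1 / A * lam ^ (1 / g) := by positivity
  rcases le_total T r with hTr | hTr
  · obtain ⟨n, hn, -, -, hn'⟩ := exists_pow_le_rpow_lt hA hg hlam
    have hcoef : 1 / A * lam ^ (1 / g) ≤ A ^ n := by
      rw [one_div, inv_mul_le_iff₀ hA₀, ← pow_succ']
      exact hn'
    calc 1 / A * lam ^ (1 / g) * (ω r - ω T) ≤ 1 / A * lam ^ (1 / g) * ω r :=
          mul_le_mul_of_nonneg_left (by linarith [hpos T]) hl
      _ ≤ A ^ n * ω r := mul_le_mul_of_nonneg_right hcoef (hpos r)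
      _ ≤ ω ((A ^ g) ^ n * r) := hiter _ _ hTr
      _ ≤ ω (lam * r) :=
          hmono (mem_Ici.2 (by positivity)) (mem_Ici.2 (by positivity)) (by gcongr)
  · have hle : ω r ≤ ω T := hmono hr (mem_Ici.2 (by linarith)) hTr
    exact (mul_nonpos_of_nonneg_of_nonpos hl (by linarith)).trans (hpos _)

lemma scaleGap_of_dil {σ τ : ℝ → ℝ} {a b : ℝ} (hab : a < b) (hτ : ∀ t, 0 ≤ τ t)
    (hσa : DilUpper σ a) (hτb : DilLower τ b) : ScaleGap σ τ := by
  obtain ⟨C, D, hC, hD, h₁⟩ := hσa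
  obtain ⟨c, D', hc, hD', h₂⟩ := hτb
  intro K hK
  set lam := (max 1 (K * C / c)) ^ (1 / (b - a)) with hlam
  have hba : 0 < b - a := sub_pos.2 hab
  have hlam₁ : 1 ≤ lam := Real.one_le_rpow (le_max_left _ _) (by positivity)
  have hlam₀ : 0 < lam := by linarith
  have hpow : lam ^ (b - a) = max 1 (K * C / c) := by
    rw [hlam, ← Real.rpow_mul (by positivity), one_div_mul_cancel hba.ne', Real.rpow_one]
  have hcomp : K * (C * lam ^ a) ≤ c * lam ^ b := by
    have h₃ : K * C / c ≤ lam ^ (b - a) := hpow ▸ le_max_right _ _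
    rw [div_le_iff₀ hc] at h₃
    have h₄ : lam ^ b = lam ^ (b - a) * lam ^ a := by
      rw [← Real.rpow_add hlam₀, sub_add_cancel]
    rw [h₄]
    nlinarith [Real.rpow_pos_of_pos hlam₀ a]
  refine ⟨lam, hlam₀, C * lam ^ a, by positivity, max (C * lam ^ a * D) (c * lam ^ b * D'),
    fun r hr => ⟨?_, ?_⟩⟩
  · linarith [h₁ lam r hlam₁ hr, le_max_left (C * lam ^ a * D) (c * lam ^ b * D')]
  · have := mul_le_mul_of_nonneg_right hcomp (hτ r)
    linarith [h₂ lam r hlam₁ hr, le_max_right (C * lam ^ a * D) (c * lam ^ b * D')]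

lemma DilUpper.exists_le_rpow {ω : ℝ → ℝ} (h : IsW0 ω) {a : ℝ} (hω : DilUpper ω a) :
    ∃ C : ℝ, 0 ≤ C ∧ ∀ s : ℝ, 0 ≤ s → ω s ≤ C * s ^ a := by
  obtain ⟨C, D, hC, hD, h'⟩ := hω
  refine ⟨C * D, by positivity, fun s hs => ?_⟩
  rcases le_total s 1 with h1 | h1
  · rw [h.2.2.1 s ⟨hs, h1⟩]
    positivity
  · have := h' s 1 h1 zero_le_one
    rw [h.2.2.1 1 (by simp), mul_one, zero_add] at this
    linarith

lemma DilLower.exists_rpow_le {ω : ℝ → ℝ} (h : IsWeightFct ω) {b : ℝ} (hb : 0 < b)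
    (hω : DilLower ω b) :
    ∃ c D : ℝ, 0 < c ∧ 0 ≤ D ∧ ∀ s : ℝ, 0 ≤ s → c * s ^ b - D ≤ ω s := by
  obtain ⟨c, D, hc, hD, h'⟩ := hω
  obtain ⟨r, hr, hr'⟩ := ((h.2.2.eventually_ge_atTop (D + 1)).and (eventually_gt_atTop 0)).exists
  refine ⟨c / r ^ b, c, by positivity, hc.le, fun s hs => ?_⟩
  have heq : c / r ^ b * s ^ b = c * (s / r) ^ b := by
    rw [Real.div_rpow hs hr'.le]
    ring
  rw [heq]
  rcases le_total s r with h1 | h1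
  · have : (s / r) ^ b ≤ 1 :=
      Real.rpow_le_one (by positivity) ((div_le_one hr').2 h1) hb.le
    nlinarith [h.1 s]
  · have h₂ := h' (s / r) r ((one_le_div hr').2 h1) hr'.le
    rw [div_mul_cancel₀ _ hr'.ne'] at h₂
    have h₃ : 0 ≤ c * (s / r) ^ b := by positivity
    nlinarith

lemma exists_mul_rpow_le {a b C c : ℝ} (ha : 0 ≤ a) (hab : a < b) (hC : 0 ≤ C) (hc : 0 < c) :
    ∃ B : ℝ, ∀ s : ℝ, 0 ≤ s → C * s ^ a ≤ c * s ^ b + B := by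
  have hba : 0 < b - a := sub_pos.2 hab
  set X := (C / c) ^ (1 / (b - a)) with hX
  have hX₀ : 0 ≤ X := by positivity
  have hpow : X ^ (b - a) = C / c := by
    rw [hX, ← Real.rpow_mul (by positivity), one_div_mul_cancel hba.ne', Real.rpow_one]
  refine ⟨C * X ^ a, fun s hs => ?_⟩
  rcases le_total s X with h | h
  · have : C * s ^ a ≤ C * X ^ a := by gcongr
    have : 0 ≤ c * s ^ b := by positivity
    linarith
  · rcases hs.eq_or_lt with rfl | hs₀
    · rw [le_antisymm h hX₀]
      have : 0 ≤ c * (0 : ℝ) ^ b := by positivity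
      linarith
    have h₁ : C / c ≤ s ^ (b - a) := hpow ▸ Real.rpow_le_rpow hX₀ h hba.le
    rw [div_le_iff₀ hc] at h₁
    have h₂ : s ^ b = s ^ (b - a) * s ^ a := by rw [← Real.rpow_add hs₀, sub_add_cancel]
    have h₃ : 0 ≤ C * X ^ a := by positivity
    rw [h₂]
    nlinarith [Real.rpow_pos_of_pos hs₀ a]

lemma upperConjWD_of_dil {σ τ : ℝ → ℝ} {a b : ℝ} (ha : 0 < a) (hab : a < b) (hσ : IsW0 σ)
    (hτ : IsW0 τ) (hσa : DilUpper σ a) (hτb : DilLower τ b) : UpperConjWD σ τ := by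
  obtain ⟨C, hC, h₁⟩ := hσa.exists_le_rpow hσ
  obtain ⟨c, D, hc, hD, h₂⟩ := hτb.exists_rpow_le hτ.1 (ha.trans hab)
  intro t ht
  obtain ⟨B, hB⟩ := exists_mul_rpow_le ha.le hab hC (by positivity : 0 < c / t ^ b)
  refine ⟨B + D, ?_⟩
  rintro _ ⟨s, hs, rfl⟩
  have h₃ := h₂ (s / t) (by positivity)
  rw [Real.div_rpow hs ht.le] at h₃
  have h₄ : c / t ^ b * s ^ b = c * (s ^ b / t ^ b) := by ring
  linarith [h₁ s hs, hB s hs]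

lemma DilUpper.exists_le_phiStar {ω : ℝ → ℝ} (h : IsW0 ω) {a : ℝ} (ha : 0 < a)
    (hω : DilUpper ω a) :
    ∃ C : ℝ, ∀ x : ℝ, 1 ≤ x → x * (1 / a * Real.log x - C) ≤ phiStar ω x := by
  obtain ⟨C, -, hC⟩ := hω.exists_le_rpow h
  refine ⟨C, fun x hx => ?_⟩
  have hx₀ : 0 < x := by linarith
  have h₁ := h.le_phiStar (x := x) (y := 1 / a * Real.log x) hx₀.le
    (mul_nonneg (by positivity) (Real.log_nonneg hx))
  have h₂ := hC (Real.exp (1 / a * Real.log x)) (Real.exp_pos _).le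
  have h₃ : Real.exp (1 / a * Real.log x) ^ a = x := by
    rw [← Real.exp_mul, mul_right_comm, one_div_mul_cancel ha.ne', one_mul, Real.exp_log hx₀]
  rw [h₃] at h₂
  linarith

lemma DilLower.exists_phiStar_le {ω : ℝ → ℝ} (h : IsW0 ω) {b : ℝ} (hb : 0 < b)
    (hω : DilLower ω b) :
    ∃ C : ℝ, ∀ x : ℝ, 1 ≤ x → phiStar ω x ≤ x * (1 / b * Real.log x + C) := by
  obtain ⟨c, D, hc, hD, h₁⟩ := hω.exists_rpow_le h.1 hb
  refine ⟨D - 1 / b * (Real.log (b * c) + 1), fun x hx => phiStar_le fun y _ => ?_⟩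
  have hx₀ : 0 < x := by linarith
  have h₂ := h₁ (Real.exp y) (Real.exp_pos y).le
  rw [← Real.exp_mul] at h₂
  have h₃ := Real.log_le_sub_one_of_pos (x := Real.exp (y * b) * (b * c) / x) (by positivity)
  rw [Real.log_div (by positivity) hx₀.ne', Real.log_mul (by positivity) (by positivity),
    Real.log_exp] at h₃
  have h₄ := mul_le_mul_of_nonneg_left h₃ (by positivity : 0 ≤ x / b)
  have e₁ : x / b * (y * b + Real.log (b * c) - Real.log x)
      = x * y + x * (1 / b * Real.log (b * c)) - x * (1 / b * Real.log x) := by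
    field_simp
  have e₂ : x / b * (Real.exp (y * b) * (b * c) / x - 1)
      = c * Real.exp (y * b) - x * (1 / b) := by field_simp
  rw [e₁, e₂] at h₄
  nlinarith

lemma seqTriangle_of_dil {σ τ : ℝ → ℝ} {a b : ℝ} (ha : 0 < a) (hab : a < b) (hσ : IsW0 σ)
    (hτ : IsW0 τ) (hσa : DilUpper σ a) (hτb : DilLower τ b) {l l₁ : ℝ} (hl : 0 < l)
    (hl₁ : 0 < l₁) : seqTriangle (assocSeq τ l₁) (assocSeq σ l) := by
  have hb : 0 < b := ha.trans hab
  obtain ⟨C₁, h₁⟩ := hσa.exists_le_phiStar hσ ha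
  obtain ⟨C₂, h₂⟩ := hτb.exists_phiStar_le hτ hb
  set E : ℝ := 1 / b * Real.log l₁ + C₂ - 1 / a * Real.log l + C₁
  have hlim : Tendsto (fun p : ℕ => Real.exp ((1 / b - 1 / a) * Real.log p + E)) atTop (𝓝 0) := by
    refine Real.tendsto_exp_atBot.comp (tendsto_atBot_add_const_right _ _ ?_)
    refine Tendsto.const_mul_atTop_of_neg ?_
      (Real.tendsto_log_atTop.comp tendsto_natCast_atTop_atTop)
    exact sub_neg.2 (one_div_lt_one_div_of_lt ha hab)
  refine squeeze_zero' (Eventually.of_forall fun p => ?_) ?_ hlim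
  · unfold assocSeq
    positivity
  filter_upwards [eventually_ge_atTop 1,
    tendsto_natCast_atTop_atTop.eventually_ge_atTop (1 / l),
    tendsto_natCast_atTop_atTop.eventually_ge_atTop (1 / l₁)] with p hp hpl hpl₁
  have hp₀ : (0 : ℝ) < p := by exact_mod_cast hp
  have hx : 1 ≤ l * p := by rwa [div_le_iff₀' hl] at hpl
  have hx₁ : 1 ≤ l₁ * p := by rwa [div_le_iff₀' hl₁] at hpl₁
  have hA := h₁ _ hx
  have hB := h₂ _ hx₁
  rw [Real.log_mul hl.ne' hp₀.ne'] at hA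
  rw [Real.log_mul hl₁.ne' hp₀.ne'] at hB
  rw [assocSeq, assocSeq, ← Real.exp_sub, ← Real.exp_mul, Real.exp_le_exp]
  rw [← le_div_iff₀' (by positivity)] at hA
  rw [← div_le_iff₀' (by positivity)] at hB
  have e : (1 / l₁ * phiStar τ (l₁ * p) - 1 / l * phiStar σ (l * p)) * (1 / (p : ℝ))
      = phiStar τ (l₁ * p) / (l₁ * p) - phiStar σ (l * p) / (l * p) := by field_simp
  rw [e]
  simp only [E]
  linarith

lemma exists_dil_of_gammaBarIdx_lt {σ τ : ℝ → ℝ} (hσ : IsWeightFct σ) (hτ : IsWeightFct τ)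
    (hidx : gammaBarIdx τ < gammaIdx σ) :
    ∃ a b : ℝ, 0 < a ∧ a < b ∧ DilUpper σ a ∧ DilLower τ b := by
  obtain ⟨_, ⟨g', ⟨hg', hτg⟩, rfl⟩, hlt⟩ := sInf_lt_iff.1 hidx
  simp only [gammaIdx, lt_iSup_iff] at hlt
  obtain ⟨g, ⟨hg, hσg⟩, hlt⟩ := hlt
  have hgg : g' < g := (ENNReal.ofReal_lt_ofReal_iff hg).1 hlt
  exact ⟨1 / g, 1 / g', by positivity, one_div_lt_one_div_of_lt hg' hgg,
    dilUpper_of_gammaProp hσ hg hσg, dilLower_of_gammaBarProp hτ hg' hτg⟩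

theorem stmt11 (σ τ : ℝ → ℝ) (hσ : IsW0 σ) (hτ : IsW0 τ)
    (hidx : gammaBarIdx τ < gammaIdx σ) :
    (UpperConjWD σ τ ↔
      ∃ ℓ : ℝ, 0 < ℓ ∧ UpperConjWD (omegaSeq (assocSeq σ ℓ)) τ) ∧
    (UpperConjWD σ τ ↔
      ∀ ℓ : ℝ, 0 < ℓ → UpperConjWD (omegaSeq (assocSeq σ ℓ)) τ) ∧
    (UpperConjWD σ τ ↔
      ∃ ℓ : ℝ, 0 < ℓ ∧ UpperConjWD σ (omegaSeq (assocSeq τ ℓ))) ∧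
    (UpperConjWD σ τ ↔
      ∀ ℓ : ℝ, 0 < ℓ → UpperConjWD σ (omegaSeq (assocSeq τ ℓ))) ∧
    (UpperConjWD σ τ ↔
      ∀ ℓ : ℝ, 0 < ℓ → ∀ ℓ₁ : ℝ, 0 < ℓ₁ → seqTriangle (assocSeq τ ℓ₁) (assocSeq σ ℓ)) ∧
    (UpperConjWD σ τ →
      ∀ ℓ : ℝ, 0 < ℓ → ∀ ℓ₁ : ℝ, 0 < ℓ₁ → ∀ ℓ₂ : ℝ, 0 < ℓ₂ → ∀ ℓ₃ : ℝ, 0 < ℓ₃ →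
        WeightEquiv (upperConj σ τ) (upperConj (omegaSeq (assocSeq σ ℓ)) τ) ∧
        WeightEquiv (upperConj σ τ) (upperConj σ (omegaSeq (assocSeq τ ℓ₁))) ∧
        WeightEquiv (upperConj σ τ)
          (upperConj (omegaSeq (assocSeq σ ℓ₂)) (omegaSeq (assocSeq τ ℓ₃)))) := by
  obtain ⟨a, b, ha, hab, hσa, hτb⟩ := exists_dil_of_gammaBarIdx_lt hσ.1 hτ.1 hidx
  have hgap := scaleGap_of_dil hab hτ.1.1 hσa hτb
  have hwd := upperConjWD_of_dil ha hab hσ hτ hσa hτb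
  have hS : ∀ l : ℝ, 0 < l → UpperConjWD (omegaSeq (assocSeq σ l)) τ := fun l hl =>
    hgap.upperConjWD (hσ.linDom_omegaSeq_left hl) (.refl τ) hwd
  have hT : ∀ l : ℝ, 0 < l → UpperConjWD σ (omegaSeq (assocSeq τ l)) := fun l hl =>
    hgap.upperConjWD (.refl σ) (hτ.linDom_omegaSeq_right hl) hwd
  refine ⟨iff_of_true hwd ⟨1, one_pos, hS 1 one_pos⟩, iff_of_true hwd hS,
    iff_of_true hwd ⟨1, one_pos, hT 1 one_pos⟩, iff_of_true hwd hT,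
    iff_of_true hwd fun l hl l₁ hl₁ => seqTriangle_of_dil ha hab hσ hτ hσa hτb hl hl₁,
    fun _ l hl l₁ hl₁ l₂ hl₂ l₃ hl₃ => ⟨?_, ?_, ?_⟩⟩
  · exact hgap.weightEquiv hσ.1.2.2 (hσ.linDom_omegaSeq_left hl) (hσ.linDom_omegaSeq_right hl)
      (.refl τ) (.refl τ) hwd
  · exact hgap.weightEquiv hσ.1.2.2 (.refl σ) (.refl σ)
      (hτ.linDom_omegaSeq_left hl₁) (hτ.linDom_omegaSeq_right hl₁) hwd
  · exact hgap.weightEquiv hσ.1.2.2 (hσ.linDom_omegaSeq_left hl₂) (hσ.linDom_omegaSeq_right hl₂)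
      (hτ.linDom_omegaSeq_left hl₃) (hτ.linDom_omegaSeq_right hl₃) hwd
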